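/- For all t in the open interval (1, 2^{1/6}), arsinh(√(t⁶-1)) - 6·√(t⁶-1)/(λ₀·t⁶ + 6·(1-λ₀)·t + 5·λ₀) < 0, where λ₀ = (6 - 6·2^{1/6}·log(1+√2)) / (7 - 6·2^{1/6}·log(1+√2)). -/

import Mathlib

noncomputable def lam0 : ℝ :=
  (6 - 6 * (2 : ℝ) ^ ((1 : ℝ)/6) * Real.log (1 + Real.sqrt 2)) /
    (7 - 6 * (2 : ℝ) ^ ((1 : ℝ)/6) * Real.log (1 + Real.sqrt 2))

lemma arsinh_comparison_deriv_poly_pos {t : ℝ} (h1 : 1 < t) (h2 : t < 9 / 8) :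
    0 < 6 * (3 * t ^ 5 * (t ^ 6 / 5 + 24 / 5 * t + 1) - (t ^ 6 - 1) * (6 / 5 * t ^ 5 + 24 / 5))
      - 3 * t ^ 2 * (t ^ 6 / 5 + 24 / 5 * t + 1) ^ 2 := by
  obtain ⟨u, rfl⟩ : ∃ u, t = 1 + u := ⟨t - 1, by ring⟩
  have hu0 : 0 < u := by linarith
  have hu1 : u ≤ 1 / 8 := by linarith
  have hpow : ∀ k : ℕ, u ^ k ≤ (1 / 8) ^ k := fun k => pow_le_pow_left₀ hu0.le hu1 k
  have hfactor : 6 * (3 * (1 + u) ^ 5 * ((1 + u) ^ 6 / 5 + 24 / 5 * (1 + u) + 1)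
        - ((1 + u) ^ 6 - 1) * (6 / 5 * (1 + u) ^ 5 + 24 / 5))
      - 3 * (1 + u) ^ 2 * ((1 + u) ^ 6 / 5 + 24 / 5 * (1 + u) + 1) ^ 2
      = u ^ 2 * (162 - 90 * u - 1197 * u ^ 2 - 11628 / 5 * u ^ 3 - 12417 / 5 * u ^ 4
        - 9084 / 5 * u ^ 5 - 5037 / 5 * u ^ 6 - 444 * u ^ 7 - 3993 / 25 * u ^ 8
        - 1182 / 25 * u ^ 9 - 273 / 25 * u ^ 10 - 42 / 25 * u ^ 11 - 3 / 25 * u ^ 12) := by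
    ring
  rw [hfactor]
  refine mul_pos (by positivity) ?_
  linarith [hpow 2, hpow 3, hpow 4, hpow 5, hpow 6, hpow 7, hpow 8, hpow 9, hpow 10, hpow 11,
    hpow 12]

lemma arsinh_sqrt_lt_of_lt {t : ℝ} (h1 : 1 < t) (h2 : t < 9 / 8) :
    Real.arsinh (√(t ^ 6 - 1)) < 6 * √(t ^ 6 - 1) / (t ^ 6 / 5 + 24 / 5 * t + 1) := by
  have hmono : StrictMonoOn (fun x : ℝ => 6 * √(x ^ 6 - 1) / (x ^ 6 / 5 + 24 / 5 * x + 1)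
      - Real.arsinh (√(x ^ 6 - 1))) (Set.Icc 1 (9 / 8)) := by
    apply strictMonoOn_of_deriv_pos (convex_Icc _ _)
    · apply ContinuousOn.sub
      · apply ContinuousOn.div (by fun_prop) (by fun_prop)
        intro x hx
        have : 0 < x := by linarith [hx.1]
        positivity
      · exact (Real.continuous_arsinh.comp (by fun_prop)).continuousOn
    · intro x hx
      rw [interior_Icc] at hx
      have hx0 : 0 < x := by linarith [hx.1]
      have hx6 : 0 < x ^ 6 - 1 := by
        have := one_lt_pow₀ hx.1 (n := 6) (by norm_num)
        linarith
      have hD : 0 < x ^ 6 / 5 + 24 / 5 * x + 1 := by positivity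
      have hs : 0 < √(x ^ 6 - 1) := Real.sqrt_pos.2 hx6
      have hss : √(x ^ 6 - 1) ^ 2 = x ^ 6 - 1 := Real.sq_sqrt hx6.le
      have hd6 : HasDerivAt (fun y : ℝ => y ^ 6) (6 * x ^ 5) x := by
        simpa using hasDerivAt_pow 6 x
      have hds : HasDerivAt (fun y : ℝ => √(y ^ 6 - 1)) (6 * x ^ 5 / (2 * √(x ^ 6 - 1))) x :=
        (hd6.sub_const 1).sqrt hx6.ne'
      have hdD : HasDerivAt (fun y : ℝ => y ^ 6 / 5 + 24 / 5 * y + 1)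
          (6 * x ^ 5 / 5 + 24 / 5 * 1) x :=
        ((hd6.div_const 5).add ((hasDerivAt_id' x).const_mul (24 / 5))).add_const 1
      have hcosh : √(1 + √(x ^ 6 - 1) ^ 2) = x ^ 3 := by
        rw [hss, show 1 + (x ^ 6 - 1) = (x ^ 3) ^ 2 by ring, Real.sqrt_sq (by positivity)]
      have hd := ((hds.const_mul 6).div hdD hD.ne').sub hds.arsinh
      refine lt_of_lt_of_eq ?_ hd.deriv.symm
      rw [hcosh]
      have heq : (6 * (6 * x ^ 5 / (2 * √(x ^ 6 - 1))) * (x ^ 6 / 5 + 24 / 5 * x + 1)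
          - 6 * √(x ^ 6 - 1) * (6 * x ^ 5 / 5 + 24 / 5 * 1)) / (x ^ 6 / 5 + 24 / 5 * x + 1) ^ 2
          - (x ^ 3)⁻¹ • (6 * x ^ 5 / (2 * √(x ^ 6 - 1)))
          = (6 * (3 * x ^ 5 * (x ^ 6 / 5 + 24 / 5 * x + 1)
            - √(x ^ 6 - 1) ^ 2 * (6 / 5 * x ^ 5 + 24 / 5))
            - 3 * x ^ 2 * (x ^ 6 / 5 + 24 / 5 * x + 1) ^ 2)
            / (√(x ^ 6 - 1) * (x ^ 6 / 5 + 24 / 5 * x + 1) ^ 2) := by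
        generalize √(x ^ 6 - 1) = s at hs
        generalize x ^ 6 / 5 + 24 / 5 * x + 1 = D at hD
        rw [smul_eq_mul]
        field_simp
        ring
      rw [heq, hss]
      exact div_pos (arsinh_comparison_deriv_poly_pos hx.1 hx.2) (by positivity)
  have := hmono (Set.left_mem_Icc.2 (by norm_num)) ⟨h1.le, h2.le⟩ h1
  norm_num at this
  linarith

lemma two_rpow_one_sixth_mem_Ioo : (2 : ℝ) ^ ((1 : ℝ) / 6) ∈ Set.Ioo (28 / 25) (9 / 8) := by
  have h6 : ((2 : ℝ) ^ ((1 : ℝ) / 6)) ^ 6 = 2 := by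
    rw [← Real.rpow_natCast, ← Real.rpow_mul (by norm_num)]
    norm_num
  have h0 : 0 ≤ (2 : ℝ) ^ ((1 : ℝ) / 6) := by positivity
  constructor
  · refine lt_of_pow_lt_pow_left₀ 6 h0 ?_
    rw [h6]
    norm_num
  · refine lt_of_pow_lt_pow_left₀ 6 (by norm_num) ?_
    rw [h6]
    norm_num

lemma log_one_add_sqrt_two_mem_Ioo : Real.log (1 + √2) ∈ Set.Ioo (43 / 50) (91 / 100) := by
  have hl : (1.414 : ℝ) < √2 := Real.lt_sqrt_of_sq_lt (by norm_num)
  have hu : √2 < 1.415 := (Real.sqrt_lt' (by norm_num)).2 (by norm_num)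
  have hpos : 0 < (1 + √2) / 2 := by positivity
  have hlog : Real.log (1 + √2) = Real.log 2 + Real.log ((1 + √2) / 2) := by
    rw [← Real.log_mul (by norm_num) hpos.ne']
    congr 1
    ring
  have hinv : ((1 + √2) / 2)⁻¹ < 0.83 := by
    rw [inv_lt_comm₀ hpos (by norm_num)]
    norm_num at hl ⊢
    linarith
  rw [hlog]
  constructor
  · linarith [Real.log_two_gt_d9, Real.one_sub_inv_le_log_of_pos hpos]
  · linarith [Real.log_two_lt_d9, Real.log_le_sub_one_of_pos hpos]

lemma lam0_mem_Icc : lam0 ∈ Set.Icc (-1) (1 / 5) := by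
  obtain ⟨hc1, hc2⟩ := two_rpow_one_sixth_mem_Ioo
  obtain ⟨hL1, hL2⟩ := log_one_add_sqrt_two_mem_Ioo
  unfold lam0
  set c := (2 : ℝ) ^ ((1 : ℝ) / 6)
  set L := Real.log (1 + √2)
  have hlow : 28 / 25 * (43 / 50) ≤ c * L := by gcongr
  have hupp : c * L ≤ 9 / 8 * (91 / 100) := by gcongr
  have hden : 0 < 7 - 6 * c * L := by linarith
  constructor
  · rw [le_div_iff₀ hden]
    linarith
  · rw [div_le_iff₀ hden]
    linarith

theorem stmt_11 (t : ℝ) (ht : t ∈ Set.Ioo 1 ((2 : ℝ) ^ ((1 : ℝ)/6))) :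
    Real.arsinh (Real.sqrt (t ^ 6 - 1)) -
      6 * Real.sqrt (t ^ 6 - 1) / (lam0 * t ^ 6 + 6 * (1 - lam0) * t + 5 * lam0) < 0 := by
  have h1 := ht.1
  have h2 : t < 9 / 8 := ht.2.trans two_rpow_one_sixth_mem_Ioo.2
  obtain ⟨hlow, hupp⟩ := lam0_mem_Icc
  have hbern : 0 ≤ t ^ 6 - 6 * t + 5 := by
    have := one_add_mul_sub_le_pow (by linarith : -1 ≤ t) 6
    norm_num at this
    linarith
  have ht6 : t ^ 6 ≤ (9 / 8) ^ 6 := by gcongr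
  have hpos : 0 < lam0 * t ^ 6 + 6 * (1 - lam0) * t + 5 * lam0 := by
    nlinarith [mul_nonneg (sub_nonneg.2 hlow) hbern]
  have hle : lam0 * t ^ 6 + 6 * (1 - lam0) * t + 5 * lam0 ≤ t ^ 6 / 5 + 24 / 5 * t + 1 := by
    nlinarith [mul_nonneg (sub_nonneg.2 hupp) hbern]
  have hdiv : 6 * √(t ^ 6 - 1) / (t ^ 6 / 5 + 24 / 5 * t + 1)
      ≤ 6 * √(t ^ 6 - 1) / (lam0 * t ^ 6 + 6 * (1 - lam0) * t + 5 * lam0) :=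
    div_le_div_of_nonneg_left (by positivity) hpos hle
  linarith [arsinh_sqrt_lt_of_lt h1 h2]
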